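/- Let ν > 0 and λ ≥ 0 be real parameters and let R > 0. Then the cumulative distribution function of the non-central chi-square distribution with ν degrees of freedom and non-centrality parameter λ satisfies the Gideon–Gurland expansion: ∫₀^R (e^{-(r+λ)/2}/2) · (r/λ)^{ν/4 - 1/2} · I_{ν/2-1}(√(λ r)) dr = (R/2)^{ν/2} · e^{-R/2} · Σ_{n=1}^∞ [(-λ/2)^n / (Γ(n + ν/2) · n)] · L_{n-1}^{ν/2}(R/2) + (1/Γ(ν/2)) · γ(ν/2, R/2), where for λ = 0 the integrand is interpreted as the central chi-square density (e^{-r/2}/2)·(r/2)^{ν/2-1}/Γ(ν/2). -/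

import Mathlib

open Real MeasureTheory

/-- The generalized Laguerre polynomial
`L_n^μ(x) = ∑_{k=0}^{n} Γ(n+μ+1)/(Γ(μ+k+1)·(n-k)!) · (-x)^k / k!`. -/
noncomputable def genLaguerre (μ : ℝ) (n : ℕ) (x : ℝ) : ℝ :=
  ∑ k ∈ Finset.range (n + 1),
    Real.Gamma (n + μ + 1) / (Real.Gamma (μ + k + 1) * (Nat.factorial (n - k) : ℝ)) *
      ((-x) ^ k / (Nat.factorial k : ℝ))

/-- The modified Bessel function of the first kind of real order `p`:
`I_p(z) = ∑_{m=0}^∞ (z/2)^{2m+p} / (m! · Γ(m+p+1))`. -/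
noncomputable def besselI (p z : ℝ) : ℝ :=
  ∑' m : ℕ, (z / 2) ^ (2 * (m : ℝ) + p) / ((Nat.factorial m : ℝ) * Real.Gamma (m + p + 1))

/-- The lower incomplete gamma function `γ(a, x) = ∫₀^x t^{a-1} e^{-t} dt`. -/
noncomputable def lowerIncGamma (a x : ℝ) : ℝ :=
  ∫ t in (0 : ℝ)..x, t ^ (a - 1) * Real.exp (-t)

/-- The non-central chi-square density, interpreted for `λ = 0` as the central
chi-square density. -/
noncomputable def noncentralChiSqPdf (ν lam r : ℝ) : ℝ :=
  if lam = 0 then Real.exp (-r / 2) / 2 * (r / 2) ^ (ν / 2 - 1) / Real.Gamma (ν / 2)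
  else Real.exp (-(r + lam) / 2) / 2 * (r / lam) ^ (ν / 4 - 1 / 2) *
    besselI (ν / 2 - 1) (Real.sqrt (lam * r))

/-- `1 / (Γ(a+k) k!)`, the coefficient of `z ^ k` in the power series for which
`I_{a-1}(2√z) = z^{(a-1)/2} ∑ z^k / (Γ(a+k) k!)`. -/
noncomputable def besselCoeff (a : ℝ) (k : ℕ) : ℝ :=
  1 / (Real.Gamma (a + k) * (Nat.factorial k : ℝ))

lemma besselCoeff_pos {a : ℝ} (ha : 0 < a) (k : ℕ) : 0 < besselCoeff a k := by
  have : 0 < Real.Gamma (a + k) := Real.Gamma_pos_of_pos (by positivity)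
  unfold besselCoeff
  positivity

lemma besselCoeff_succ {a : ℝ} (ha : 0 < a) (k : ℕ) :
    besselCoeff a (k + 1) = besselCoeff a k / ((a + k) * (k + 1)) := by
  have hak : 0 < a + k := by positivity
  have hG : Real.Gamma (a + k) ≠ 0 := (Real.Gamma_pos_of_pos hak).ne'
  have hrec : Real.Gamma (a + ((k + 1 : ℕ) : ℝ)) = (a + k) * Real.Gamma (a + k) := by
    rw [← Real.Gamma_add_one hak.ne']
    push_cast
    ring_nf
  unfold besselCoeff
  rw [hrec, Nat.factorial_succ]
  push_cast
  field_simp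

lemma summable_norm_pow_mul_besselCoeff {a : ℝ} (ha : 0 < a) (y : ℝ) :
    Summable fun k : ℕ => ‖y ^ k * besselCoeff a k‖ := by
  refine Summable.norm (summable_of_ratio_norm_eventually_le (r := 1 / 2) (by norm_num) ?_)
  filter_upwards [Filter.eventually_ge_atTop ⌈2 * |y| / a⌉₊] with n hn
  have hn' : 2 * |y| ≤ n * a := (div_le_iff₀ ha).1 (Nat.ceil_le.1 hn)
  have hc := besselCoeff_pos ha n
  have hden : 0 < (a + n) * ((n : ℝ) + 1) := by positivity
  rw [besselCoeff_succ ha, norm_mul, norm_mul, norm_div, norm_pow, norm_pow, Real.norm_eq_abs,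
    Real.norm_of_nonneg hc.le, Real.norm_of_nonneg hden.le, pow_succ]
  have hratio : |y| / ((a + n) * ((n : ℝ) + 1)) ≤ 1 / 2 := by
    rw [div_le_iff₀ hden]
    nlinarith [Nat.cast_nonneg (α := ℝ) n]
  calc |y| ^ n * |y| * (besselCoeff a n / ((a + n) * ((n : ℝ) + 1)))
      = |y| / ((a + n) * ((n : ℝ) + 1)) * (|y| ^ n * besselCoeff a n) := by ring
    _ ≤ 1 / 2 * (|y| ^ n * besselCoeff a n) := by gcongr

lemma summable_norm_pow_div_factorial (y : ℝ) :
    Summable fun j : ℕ => ‖y ^ j / (Nat.factorial j : ℝ)‖ :=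
  (Real.summable_pow_div_factorial y).norm

/-- Each weighted Laguerre polynomial is a term of a Cauchy product. -/
lemma pow_div_Gamma_mul_genLaguerre {a : ℝ} (ha : 0 < a) (l t : ℝ) (n : ℕ) :
    (-l) ^ n / Real.Gamma (n + a) * genLaguerre (a - 1) n t =
      ∑ p ∈ Finset.HasAntidiagonal.antidiagonal n, (l * t) ^ p.1 * besselCoeff a p.1 *
        ((-l) ^ p.2 / (Nat.factorial p.2 : ℝ)) := by
  have hG : Real.Gamma (n + a) ≠ 0 := (Real.Gamma_pos_of_pos (by positivity)).ne'
  rw [Finset.Nat.sum_antidiagonal_eq_sum_range_succ_mk, genLaguerre, Finset.mul_sum]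
  refine Finset.sum_congr rfl fun k hk => ?_
  have hkn : k ≤ n := Nat.lt_succ_iff.1 (Finset.mem_range.1 hk)
  have hGk : Real.Gamma (a + k) ≠ 0 := (Real.Gamma_pos_of_pos (by positivity)).ne'
  have e1 : (n : ℝ) + (a - 1) + 1 = n + a := by ring
  have e2 : a - 1 + (k : ℝ) + 1 = a + k := by ring
  have e3 : (-l) ^ n = (-l) ^ k * (-l) ^ (n - k) := by rw [← pow_add, Nat.add_sub_cancel' hkn]
  have e4 : (l * t) ^ k = (-l) ^ k * (-t) ^ k := by rw [← mul_pow, neg_mul_neg]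
  dsimp only
  rw [e1, e2, e3, e4, besselCoeff]
  field_simp

/-- The generating function `∑ (-l)^n L_n^{a-1}(t) / Γ(n+a) = e^{-l} ∑ (lt)^k / (Γ(a+k) k!)`. -/
lemma hasSum_genLaguerre {a : ℝ} (ha : 0 < a) (l t : ℝ) :
    HasSum (fun n : ℕ => (-l) ^ n / Real.Gamma (n + a) * genLaguerre (a - 1) n t)
      (Real.exp (-l) * ∑' k : ℕ, (l * t) ^ k * besselCoeff a k) := by
  have h1 := summable_norm_pow_mul_besselCoeff ha (l * t)
  have h2 := summable_norm_pow_div_factorial (-l)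
  have hexp : Real.exp (-l) = ∑' j : ℕ, (-l) ^ j / (Nat.factorial j : ℝ) := by
    rw [Real.exp_eq_exp_ℝ, NormedSpace.exp_eq_tsum_div]
  rw [hexp, mul_comm, tsum_mul_tsum_eq_tsum_sum_antidiagonal_of_summable_norm h1 h2]
  simp_rw [pow_div_Gamma_mul_genLaguerre ha]
  exact (summable_norm_sum_mul_antidiagonal_of_summable_norm h1 h2).of_norm.hasSum

lemma continuous_genLaguerre (μ : ℝ) (n : ℕ) : Continuous (genLaguerre μ n) := by
  unfold genLaguerre
  fun_prop

lemma norm_genLaguerre_term_le {a : ℝ} (ha : 0 < a) (l : ℝ) {t x : ℝ} (ht : 0 ≤ t) (htx : t ≤ x)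
    (n : ℕ) :
    ‖(-l) ^ n / Real.Gamma (n + a) * genLaguerre (a - 1) n t‖ ≤
      ∑ p ∈ Finset.HasAntidiagonal.antidiagonal n, (|l| * x) ^ p.1 * besselCoeff a p.1 *
        (|l| ^ p.2 / (Nat.factorial p.2 : ℝ)) := by
  rw [pow_div_Gamma_mul_genLaguerre ha]
  refine (norm_sum_le _ _).trans (Finset.sum_le_sum fun p _ => ?_)
  have hc := (besselCoeff_pos ha p.1).le
  rw [norm_mul, norm_mul, norm_div, norm_pow, norm_pow, norm_mul, Real.norm_of_nonneg hc,
    norm_neg, Real.norm_of_nonneg ht, Real.norm_natCast, Real.norm_eq_abs]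
  gcongr

/-- `d/dx [x^a e^{-x} L_n^a(x)] = (n+1) x^{a-1} e^{-x} L_{n+1}^{a-1}(x)`. -/
lemma hasDerivAt_rpow_mul_exp_mul_genLaguerre {a : ℝ} (ha : 0 < a) (n : ℕ) {x : ℝ} (hx : 0 < x) :
    HasDerivAt (fun y : ℝ => y ^ a * Real.exp (-y) * genLaguerre a n y)
      ((n + 1) * (x ^ (a - 1) * Real.exp (-x) * genLaguerre (a - 1) (n + 1) x)) x := by
  set A : ℕ → ℝ := fun k =>
    Real.Gamma (n + a + 1) / (Real.Gamma (a + k + 1) * (Nat.factorial (n - k) : ℝ)) /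
      (Nat.factorial k : ℝ) with hA
  set B : ℕ → ℝ := fun k =>
    Real.Gamma (n + a + 1) / (Real.Gamma (a + k) * (Nat.factorial (n + 1 - k) : ℝ)) /
      (Nat.factorial k : ℝ) with hB
  have hL : ∀ y, genLaguerre a n y = ∑ k ∈ Finset.range (n + 1), A k * (-y) ^ k := by
    intro y
    refine Finset.sum_congr rfl fun k _ => ?_
    rw [hA]
    ring
  have hL' : genLaguerre (a - 1) (n + 1) x = ∑ k ∈ Finset.range (n + 2), B k * (-x) ^ k := by
    refine Finset.sum_congr rfl fun k _ => ?_
    have e1 : ((n + 1 : ℕ) : ℝ) + (a - 1) + 1 = n + a + 1 := by push_cast; ring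
    have e2 : a - 1 + (k : ℝ) + 1 = a + k := by ring
    rw [hB, e1, e2]
    ring
  have hlow : ∀ k ∈ Finset.range (n + 1), (a + k) * A k = (n + 1 - k) * B k := by
    intro k hk
    have hkn : k ≤ n := Nat.lt_succ_iff.1 (Finset.mem_range.1 hk)
    have hak : 0 < a + k := by positivity
    have hG : Real.Gamma (a + k) ≠ 0 := (Real.Gamma_pos_of_pos hak).ne'
    have hnk : ((n + 1 - k : ℕ) : ℝ) = n + 1 - k := by
      rw [Nat.cast_sub (by omega)]; push_cast; ring
    have hne : (n : ℝ) + 1 - k ≠ 0 := by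
      have : (k : ℝ) ≤ n := by exact_mod_cast hkn
      linarith
    have hf : (Nat.factorial (n + 1 - k) : ℝ) = (n + 1 - k) * (Nat.factorial (n - k) : ℝ) := by
      rw [← hnk, show n + 1 - k = (n - k) + 1 by omega, Nat.factorial_succ, Nat.cast_mul]
    simp only [hA, hB]
    rw [Real.Gamma_add_one hak.ne', hf]
    field_simp
  have hshift : ∀ k, A k = (k + 1) * B (k + 1) := by
    intro k
    have hG : Real.Gamma (a + k + 1) ≠ 0 := (Real.Gamma_pos_of_pos (by positivity)).ne'
    simp only [hA, hB]
    rw [Nat.add_sub_add_right, Nat.factorial_succ]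
    push_cast
    rw [← add_assoc]
    field_simp
  have hterm : ∀ k : ℕ, HasDerivAt (fun y : ℝ => y ^ a * Real.exp (-y) * (A k * (-y) ^ k))
      (x ^ (a - 1) * Real.exp (-x) *
        ((a + k) * A k * (-x) ^ k + A k * (-x) ^ (k + 1))) x := by
    intro k
    have h1 : HasDerivAt (fun y : ℝ => y ^ a) (a * x ^ (a - 1)) x :=
      Real.hasDerivAt_rpow_const (Or.inl hx.ne')
    have h2 : HasDerivAt (fun y : ℝ => Real.exp (-y)) (Real.exp (-x) * (-1)) x :=
      (hasDerivAt_neg x).exp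
    have h3 : HasDerivAt (fun y : ℝ => A k * (-y) ^ k) (A k * (k * (-x) ^ (k - 1) * (-1))) x :=
      ((hasDerivAt_neg x).fun_pow k).const_mul (A k)
    refine ((h1.fun_mul h2).fun_mul h3).congr_deriv ?_
    have hxa : x ^ a = x ^ (a - 1) * x := by
      rw [← Real.rpow_add_one hx.ne', sub_add_cancel]
    rw [hxa]
    rcases k with _ | k
    · simp; ring
    · simp only [Nat.add_sub_cancel]
      push_cast
      ring
  have hsum : HasDerivAt (fun y : ℝ => y ^ a * Real.exp (-y) * genLaguerre a n y)
      (∑ k ∈ Finset.range (n + 1), x ^ (a - 1) * Real.exp (-x) *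
        ((a + k) * A k * (-x) ^ k + A k * (-x) ^ (k + 1))) x := by
    simp_rw [hL, Finset.mul_sum]
    exact HasDerivAt.fun_sum fun k _ => hterm k
  refine hsum.congr_deriv ?_
  rw [← Finset.mul_sum, Finset.sum_add_distrib, hL', mul_left_comm]
  congr 1
  have s1 : ∑ k ∈ Finset.range (n + 1), (a + k) * A k * (-x) ^ k =
      ∑ k ∈ Finset.range (n + 2), (n + 1 - k) * B k * (-x) ^ k := by
    rw [Finset.sum_range_succ _ (n + 1)]
    push_cast
    rw [sub_self, zero_mul, zero_mul, add_zero]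
    exact Finset.sum_congr rfl fun k hk => by rw [hlow k hk]
  have s2 : ∑ k ∈ Finset.range (n + 1), A k * (-x) ^ (k + 1) =
      ∑ k ∈ Finset.range (n + 2), k * B k * (-x) ^ k := by
    rw [Finset.sum_range_succ' _ (n + 1)]
    push_cast
    rw [zero_mul, zero_mul, add_zero]
    exact Finset.sum_congr rfl fun k _ => by rw [hshift k]
  rw [s1, s2, ← Finset.sum_add_distrib, Finset.mul_sum]
  exact Finset.sum_congr rfl fun k _ => by ring

lemma intervalIntegrable_rpow_mul_exp {a : ℝ} (ha : 0 < a) (x : ℝ) {g : ℝ → ℝ}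
    (hg : Continuous g) :
    IntervalIntegrable (fun t : ℝ => t ^ (a - 1) * Real.exp (-t) * g t) volume 0 x := by
  simp_rw [mul_assoc]
  exact (intervalIntegral.intervalIntegrable_rpow' (by linarith)).mul_continuousOn
    (by fun_prop : Continuous fun t => Real.exp (-t) * g t).continuousOn

lemma integral_rpow_mul_exp_mul_genLaguerre {a : ℝ} (ha : 0 < a) (n : ℕ) {x : ℝ} (hx : 0 ≤ x) :
    ∫ t in (0 : ℝ)..x, t ^ (a - 1) * Real.exp (-t) * genLaguerre (a - 1) (n + 1) t =
      x ^ a * Real.exp (-x) * genLaguerre a n x / (n + 1) := by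
  have hcont : Continuous fun y : ℝ => y ^ a * Real.exp (-y) * genLaguerre a n y :=
    ((Real.continuous_rpow_const ha.le).mul (by fun_prop)).mul (continuous_genLaguerre a n)
  have h := intervalIntegral.integral_eq_sub_of_hasDerivAt_of_le hx hcont.continuousOn
    (fun y hy => hasDerivAt_rpow_mul_exp_mul_genLaguerre ha n hy.1)
    ((intervalIntegrable_rpow_mul_exp ha x (continuous_genLaguerre _ _)).const_mul _)
  rw [intervalIntegral.integral_const_mul, Real.zero_rpow ha.ne', zero_mul, zero_mul,
    sub_zero] at h
  rw [← h]
  field_simp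

/-- Termwise integration of the Laguerre expansion of the density. -/
lemma hasSum_integral_genLaguerre {a : ℝ} (ha : 0 < a) (l : ℝ) {x : ℝ} (hx : 0 ≤ x) :
    HasSum (fun n : ℕ => ∫ t in (0 : ℝ)..x, t ^ (a - 1) * Real.exp (-t) *
        ((-l) ^ n / Real.Gamma (n + a) * genLaguerre (a - 1) n t))
      (∫ t in (0 : ℝ)..x, t ^ (a - 1) * Real.exp (-t) *
        (Real.exp (-l) * ∑' k : ℕ, (l * t) ^ k * besselCoeff a k)) := by
  set b : ℕ → ℝ := fun n => ∑ p ∈ Finset.HasAntidiagonal.antidiagonal n, (|l| * x) ^ p.1 * besselCoeff a p.1 *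
    (|l| ^ p.2 / (Nat.factorial p.2 : ℝ)) with hb
  have hbsum : Summable b :=
    (summable_norm_sum_mul_antidiagonal_of_summable_norm
      (summable_norm_pow_mul_besselCoeff ha (|l| * x))
      (summable_norm_pow_div_factorial |l|)).of_norm
  refine intervalIntegral.hasSum_integral_of_dominated_convergence
    (fun n t => t ^ (a - 1) * b n) (fun n => ?_) (fun n => ?_) ?_ ?_ ?_
  · exact (intervalIntegrable_rpow_mul_exp ha x
      ((continuous_genLaguerre (a - 1) n).const_mul _)).def'.aestronglyMeasurable
  · refine Filter.Eventually.of_forall fun t ht => ?_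
    rw [Set.uIoc_of_le hx] at ht
    have hp : 0 ≤ t ^ (a - 1) := Real.rpow_nonneg ht.1.le _
    rw [norm_mul, norm_mul, Real.norm_of_nonneg hp, Real.norm_of_nonneg (Real.exp_pos _).le]
    refine mul_le_mul ?_ (norm_genLaguerre_term_le ha l ht.1.le ht.2 n) (norm_nonneg _) hp
    exact mul_le_of_le_one_right hp (Real.exp_le_one_iff.2 (by linarith [ht.1]))
  · exact Filter.Eventually.of_forall fun t _ => hbsum.mul_left _
  · simp_rw [tsum_mul_left]
    exact (intervalIntegral.intervalIntegrable_rpow' (by linarith)).mul_const _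
  · exact Filter.Eventually.of_forall fun t _ => (hasSum_genLaguerre ha l t).mul_left _

lemma noncentralChiSqPdf_eq {ν lam r : ℝ} (hlam : 0 ≤ lam) (hr : 0 < r) :
    noncentralChiSqPdf ν lam r =
      (1 / 2) * ((r / 2) ^ (ν / 2 - 1) * Real.exp (-(r / 2)) *
        (Real.exp (-(lam / 2)) *
          ∑' k : ℕ, (lam / 2 * (r / 2)) ^ k * besselCoeff (ν / 2) k)) := by
  unfold noncentralChiSqPdf
  split_ifs with h
  · subst h
    rw [tsum_eq_single 0 (fun k hk => by simp [hk])]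
    simp [besselCoeff, neg_div]
    ring
  · have hl : 0 < lam := lt_of_le_of_ne hlam (Ne.symm h)
    have hz : 0 < √(lam * r) / 2 := by positivity
    have hz2 : (√(lam * r) / 2) ^ 2 = lam / 2 * (r / 2) := by
      rw [div_pow, Real.sq_sqrt (by positivity)]
      ring
    have hB : besselI (ν / 2 - 1) √(lam * r) = (√(lam * r) / 2) ^ (ν / 2 - 1) *
        ∑' k : ℕ, (lam / 2 * (r / 2)) ^ k * besselCoeff (ν / 2) k := by
      rw [besselI, ← tsum_mul_left]
      refine tsum_congr fun k => ?_
      have e : (k : ℝ) + (ν / 2 - 1) + 1 = ν / 2 + k := by ring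
      have e2 : (2 * (k : ℝ)) = ((2 * k : ℕ) : ℝ) := by push_cast; ring
      rw [Real.rpow_add hz, e2, Real.rpow_natCast, pow_mul, hz2, e, besselCoeff]
      ring
    have hpow : (r / lam) ^ (ν / 4 - 1 / 2) * (√(lam * r) / 2) ^ (ν / 2 - 1) =
        (r / 2) ^ (ν / 2 - 1) := by
      have e : ν / 2 - 1 = 2 * (ν / 4 - 1 / 2) := by ring
      rw [e, Real.rpow_mul hz.le, Real.rpow_mul (by positivity : 0 ≤ r / 2), Real.rpow_two,
        Real.rpow_two, hz2, ← Real.mul_rpow (by positivity) (by positivity)]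
      congr 1
      field_simp
    have hexp : Real.exp (-(r + lam) / 2) = Real.exp (-(r / 2)) * Real.exp (-(lam / 2)) := by
      rw [← Real.exp_add]
      ring_nf
    rw [hB, hexp, ← hpow]
    ring

lemma integral_noncentralChiSqPdf {ν lam R : ℝ} (hlam : 0 ≤ lam) (hR : 0 ≤ R) :
    ∫ r in (0 : ℝ)..R, noncentralChiSqPdf ν lam r =
      ∫ t in (0 : ℝ)..R / 2, t ^ (ν / 2 - 1) * Real.exp (-t) *
        (Real.exp (-(lam / 2)) * ∑' k : ℕ, (lam / 2 * t) ^ k * besselCoeff (ν / 2) k) := by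
  set g : ℝ → ℝ := fun t => t ^ (ν / 2 - 1) * Real.exp (-t) *
    (Real.exp (-(lam / 2)) * ∑' k : ℕ, (lam / 2 * t) ^ k * besselCoeff (ν / 2) k) with hg
  have h : ∫ r in (0 : ℝ)..R, noncentralChiSqPdf ν lam r =
      ∫ r in (0 : ℝ)..R, (1 / 2) * g (r / 2) := by
    refine intervalIntegral.integral_congr_ae (Filter.Eventually.of_forall fun r hr => ?_)
    rw [Set.uIoc_of_le hR] at hr
    exact noncentralChiSqPdf_eq hlam hr.1
  rw [h, intervalIntegral.integral_const_mul, intervalIntegral.integral_comp_div g two_ne_zero,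
    zero_div, smul_eq_mul, ← mul_assoc]
  norm_num

/-- The Gideon–Gurland Laguerre expansion of the non-central chi-square cdf:
for `ν > 0`, `λ ≥ 0` and `R > 0`,
`∫₀^R f_{χ²_{ν,λ}}(r) dr = (R/2)^{ν/2} e^{-R/2} ∑_{n=1}^∞ (-λ/2)^n /(Γ(n+ν/2)·n) ·
  L_{n-1}^{ν/2}(R/2) + γ(ν/2, R/2)/Γ(ν/2)`. -/
theorem gideon_gurland_expansion (ν lam : ℝ) (hν : 0 < ν) (hlam : 0 ≤ lam)
    (R : ℝ) (hR : 0 < R) :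
    ∫ r in (0 : ℝ)..R, noncentralChiSqPdf ν lam r =
      (R / 2) ^ (ν / 2) * Real.exp (-R / 2) *
          (∑' n : ℕ, (-lam / 2) ^ (n + 1) /
              (Real.Gamma ((n : ℝ) + 1 + ν / 2) * ((n : ℝ) + 1)) *
            genLaguerre (ν / 2) n (R / 2)) +
        (1 / Real.Gamma (ν / 2)) * lowerIncGamma (ν / 2) (R / 2) := by
  have ha : 0 < ν / 2 := by positivity
  have hx : 0 ≤ R / 2 := by positivity
  have hs := hasSum_integral_genLaguerre ha (lam / 2) hx
  have hG : Real.Gamma (ν / 2) ≠ 0 := (Real.Gamma_pos_of_pos ha).ne'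
  rw [integral_noncentralChiSqPdf hlam hR.le, ← hs.tsum_eq, hs.summable.tsum_eq_zero_add,
    add_comm, ← tsum_mul_left]
  congr 1
  · refine tsum_congr fun n => ?_
    simp_rw [mul_left_comm _ ((-(lam / 2)) ^ (n + 1) / _) _]
    rw [intervalIntegral.integral_const_mul, integral_rpow_mul_exp_mul_genLaguerre ha n hx]
    push_cast
    rw [neg_div, neg_div, ← div_div]
    ring
  · rw [lowerIncGamma, ← intervalIntegral.integral_const_mul]
    refine intervalIntegral.integral_congr fun t _ => ?_
    simp [genLaguerre, hG]
    ring
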